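/- arXiv:1711.09636 — 7 statements merged into one kernel-verified Lean document; each statement's English description precedes it below -/
import Mathlib

section
/- Let X be a locally compact, non-compact, Hausdorff, hereditarily normal (T5) topological space. Then the Alexandroff one-point compactification of X (Mathlib's OnePoint X) is a hereditarily normal Hausdorff (T5) space. -/
open Set Filter Topology

/-- Separated subsets of a regular space, one of which lies in the range of an open embedding of a
completely normal space whose complement is at most one point, have disjoint neighbourhoods. -/
theorem Topology.IsOpenEmbedding.disjoint_nhdsSet_of_subset_insert_range
    {X Y : Type*} [TopologicalSpace X] [TopologicalSpace Y] [CompletelyNormalSpace X]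
    [RegularSpace Y] {e : X → Y} (he : IsOpenEmbedding e) {p : Y} {s t : Set Y}
    (hs : s ⊆ insert p (range e)) (ht : t ⊆ range e)
    (hst : Disjoint (closure s) t) (hts : Disjoint s (closure t)) :
    Disjoint (𝓝ˢ s) (𝓝ˢ t) := by
  have hrange : Disjoint (𝓝ˢ (s ∩ range e)) (𝓝ˢ t) := by
    rw [← image_preimage_eq_inter_range, ← image_preimage_eq_of_subset ht,
      ← he.isOpenMap.map_nhdsSet_eq he.continuous,
      ← he.isOpenMap.map_nhdsSet_eq he.continuous, disjoint_map he.injective]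
    apply CompletelyNormalSpace.completely_normal
    · exact (hst.preimage e).mono_left (he.continuous.closure_preimage_subset s)
    · exact (hts.preimage e).mono_right (he.continuous.closure_preimage_subset t)
  by_cases hp : p ∈ s
  · have hpt : Disjoint (𝓝ˢ {p}) (𝓝ˢ t) := by
      rw [nhdsSet_singleton, disjoint_comm, disjoint_nhdsSet_nhds]
      exact disjoint_left.1 hts hp
    have hcover : s ⊆ {p} ∪ s ∩ range e := fun x hx =>
      (hs hx).imp (fun h => h) fun h => ⟨hx, h⟩
    refine Disjoint.mono_left (nhdsSet_mono hcover) ?_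
    rw [nhdsSet_union]
    exact hpt.sup_left hrange
  · rwa [inter_eq_left.2 ((subset_insert_iff_of_notMem hp).1 hs)] at hrange

/-- Alexandroff's theorem, T₅ case: the one-point compactification of a locally compact,
non-compact, Hausdorff, hereditarily normal (T₅) space is hereditarily normal Hausdorff (T₅). -/
theorem onePoint_t5Space {X : Type u} [TopologicalSpace X] [T2Space X] [T5Space X]
    [LocallyCompactSpace X] [NoncompactSpace X] :
    T5Space (OnePoint X) := by
  have hcover (s : Set (OnePoint X)) : s ⊆ insert OnePoint.infty (range OnePoint.some) := by
    intro x _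
    induction x with
    | infty => exact mem_insert _ _
    | coe x => exact mem_insert_of_mem _ (mem_range_self x)
  have he : IsOpenEmbedding (OnePoint.some : X → OnePoint X) := OnePoint.isOpenEmbedding_coe
  refine { completely_normal := fun s t hst hts => ?_ }
  by_cases hs : OnePoint.infty ∈ s
  · have ht : OnePoint.infty ∉ t := disjoint_left.1 (hst.mono_left subset_closure) hs
    exact he.disjoint_nhdsSet_of_subset_insert_range (hcover s)
      ((subset_insert_iff_of_notMem ht).1 (hcover t)) hst hts
  · exact (he.disjoint_nhdsSet_of_subset_insert_range (hcover t)
      ((subset_insert_iff_of_notMem hs).1 (hcover s)) hts.symm hst.symm).symm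
end

section
/- Let ℕ carry the discrete topology, let βℕ = StoneCech ℕ be its Stone–Čech compactification with canonical embedding ι : ℕ → βℕ, and let p ∈ βℕ be a point not in the image ι(ℕ). Then the subspace X = ι(ℕ) ∪ {p} of βℕ is not metrizable (even though for every open neighborhood U of p in X the subspace X ∖ U is metrizable). -/
open Filter Topology

/-- Every sequence in `ℕ` whose image converges in `βℕ` to a point outside `ℕ` tends to infinity. -/
theorem tendsto_atTop_of_tendsto_stoneCechUnit {p : StoneCech ℕ}
    (hp : p ∉ Set.range (stoneCechUnit : ℕ → StoneCech ℕ)) {u : ℕ → ℕ}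
    (hu : Tendsto (fun n => stoneCechUnit (u n)) atTop (𝓝 p)) : Tendsto u atTop atTop := by
  rw [← Nat.cofinite_eq_atTop]
  refine le_cofinite_iff_eventually_ne.2 fun k => ?_
  have hne : p ≠ stoneCechUnit k := fun h => hp ⟨k, h.symm⟩
  have h := hu.eventually_ne hne
  rw [Nat.cofinite_eq_atTop, eventually_map]
  exact h.mono fun n hn hk => hn (by rw [hk])

/-- The image in `βℕ` of an injective sequence in `ℕ` does not converge. -/
theorem not_tendsto_stoneCechUnit_of_injective {v : ℕ → ℕ} (hv : Function.Injective v)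
    (p : StoneCech ℕ) : ¬ Tendsto (fun n => stoneCechUnit (v n)) atTop (𝓝 p) := by
  classical
  intro h
  let f : ℕ → Bool := fun m => decide (∃ k, m = v (2 * k))
  have hf : Continuous f := continuous_of_discreteTopology
  have hlim : Tendsto (fun n => f (v n)) atTop (𝓝 (stoneCechExtend hf p)) := by
    simpa [Function.comp_def, stoneCechExtend_stoneCechUnit] using
      ((continuous_stoneCechExtend hf).tendsto p).comp h
  rw [nhds_discrete, tendsto_pure] at hlim
  obtain ⟨N, hN⟩ := eventually_atTop.1 hlim
  have heven : f (v (2 * N)) = true := decide_eq_true ⟨N, rfl⟩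
  have hodd : f (v (2 * N + 1)) = false := decide_eq_false fun ⟨k, hk⟩ => by
    have := hv hk
    omega
  have h1 := hN (2 * N) (by omega)
  have h2 := hN (2 * N + 1) (by omega)
  rw [heven] at h1
  rw [hodd, ← h1] at h2
  exact Bool.noConfusion h2

/-- No sequence in `ℕ` converges in `βℕ` to a point outside `ℕ`. -/
theorem not_tendsto_stoneCechUnit_of_notMem_range {p : StoneCech ℕ}
    (hp : p ∉ Set.range (stoneCechUnit : ℕ → StoneCech ℕ)) (u : ℕ → ℕ) :
    ¬ Tendsto (fun n => stoneCechUnit (u n)) atTop (𝓝 p) := by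
  intro hu
  obtain ⟨φ, hφ, huφ⟩ :=
    strictMono_subseq_of_tendsto_atTop (tendsto_atTop_of_tendsto_stoneCechUnit hp hu)
  exact not_tendsto_stoneCechUnit_of_injective huφ.injective p (hu.comp hφ.tendsto_atTop)

/-- Points of a discrete space are isolated in its image in the Stone–Čech compactification. -/
theorem exists_isOpen_stoneCechUnit_mem_iff {α : Type*} [TopologicalSpace α] [DiscreteTopology α]
    (a : α) : ∃ V : Set (StoneCech α), IsOpen V ∧ ∀ b, stoneCechUnit b ∈ V ↔ b = a := by
  classical
  have hf : Continuous fun b : α => decide (b = a) := continuous_of_discreteTopology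
  refine ⟨stoneCechExtend hf ⁻¹' {true},
    (isOpen_discrete _).preimage (continuous_stoneCechExtend hf), fun b => ?_⟩
  simp [stoneCechExtend_stoneCechUnit]


/-- Let `p` be a point of the Stone–Čech compactification of the discrete space `ℕ` outside
the image of `ℕ`. Then the subspace `ι(ℕ) ∪ {p}` of `βℕ` is not metrizable, even though
for every open neighborhood `U` of `p` in it, the complement of `U` is metrizable. -/
theorem stoneCech_nat_union_point_not_metrizable
    (p : StoneCech ℕ) (hp : p ∉ Set.range (stoneCechUnit : ℕ → StoneCech ℕ)) :
    ¬ TopologicalSpace.MetrizableSpace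
        ↥(insert p (Set.range (stoneCechUnit : ℕ → StoneCech ℕ))) ∧
      ∀ U : Set ↥(insert p (Set.range (stoneCechUnit : ℕ → StoneCech ℕ))),
        IsOpen U →
        (⟨p, Set.mem_insert _ _⟩ :
          ↥(insert p (Set.range (stoneCechUnit : ℕ → StoneCech ℕ)))) ∈ U →
        TopologicalSpace.MetrizableSpace ↥(Uᶜ) := by
  refine ⟨fun hmet => ?_, fun U _ hpU => ?_⟩
  · let X : Set (StoneCech ℕ) := insert p (Set.range stoneCechUnit)
    let j : ℕ → X := fun n => ⟨stoneCechUnit n, Set.mem_insert_of_mem _ ⟨n, rfl⟩⟩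
    have : TopologicalSpace.MetrizableSpace X := hmet
    have hcl : (⟨p, Set.mem_insert _ _⟩ : X) ∈ closure (Set.range j) := by
      rw [closure_subtype, ← Set.range_comp]
      exact denseRange_stoneCechUnit p
    obtain ⟨x, hx, hlim⟩ := mem_closure_iff_seq_limit.1 hcl
    choose u hu using hx
    refine not_tendsto_stoneCechUnit_of_notMem_range hp u ?_
    have hcoe := (continuous_subtype_val.tendsto _).comp hlim
    exact hcoe.congr fun n => (congrArg Subtype.val (hu n)).symm
  · have hrange : ∀ x : ↥(Uᶜ), ∃ n : ℕ, stoneCechUnit n = x.1.1 := by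
      rintro ⟨⟨x, rfl | hx⟩, hxU⟩
      · exact absurd hpU hxU
      · exact hx
    have : DiscreteTopology ↥(Uᶜ) := by
      refine discreteTopology_iff_isOpen_singleton.2 fun x => ?_
      obtain ⟨n, hn⟩ := hrange x
      obtain ⟨V, hV, hVn⟩ := exists_isOpen_stoneCechUnit_mem_iff n
      convert hV.preimage (continuous_subtype_val.comp continuous_subtype_val) using 1
      ext y
      obtain ⟨m, hm⟩ := hrange y
      simp only [Set.mem_singleton_iff, Set.mem_preimage, Function.comp_apply]
      rw [← hm, hVn]
      constructor
      · rintro rfl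
        have hmV := (hVn n).2 rfl
        rwa [hn, ← hm, hVn] at hmV
      · rintro rfl
        exact Subtype.ext (Subtype.ext (hm.symm.trans hn))
    infer_instance
end

section
/- Let X be a nonempty locally connected Tychonoff (completely regular Hausdorff) space each of whose connected components is non-compact, and let βX = StoneCech X with canonical embedding ι : X → βX. Then there exists a nonempty compact subset Z of βX such that Z is disjoint from ι(X) and Z ∩ closure(ι(C)) ≠ ∅ for every connected component C of X. -/
universe u

open Topology

/-- The closure in `βX` of a closed non-compact subset of `X` contains a point outside `X`. -/
theorem exists_mem_closure_image_stoneCechUnit_notMem_range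
    {X : Type u} [TopologicalSpace X] [T35Space X] {s : Set X}
    (hs : IsClosed s) (hsc : ¬ IsCompact s) :
    ∃ p ∈ closure ((stoneCechUnit : X → StoneCech X) '' s),
      p ∉ Set.range (stoneCechUnit : X → StoneCech X) := by
  by_contra! h
  refine hsc ?_
  have hi : IsInducing (stoneCechUnit : X → StoneCech X) := isInducing_stoneCechUnit
  have := hi.isCompact_preimage' isClosed_closure.isCompact h
  rwa [← hi.closure_eq_preimage_closure_image, hs.closure_eq] at this

/-- A clopen subset of `X` and its complement are separated by a clopen subset of `βX`. -/
theorem exists_isClopen_stoneCech_of_isClopen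
    {X : Type u} [TopologicalSpace X] {s : Set X} (hs : IsClopen s) :
    ∃ U : Set (StoneCech X), IsClopen U ∧ stoneCechUnit ⁻¹' U = s := by
  have hc : Continuous (ULift.up.{u} ∘ s.boolIndicator) :=
    continuous_uliftUp.comp ((continuous_boolIndicator_iff_isClopen s).2 hs)
  refine ⟨stoneCechExtend hc ⁻¹' {ULift.up true},
    (isClopen_discrete _).preimage (continuous_stoneCechExtend hc), ?_⟩
  rw [← Set.preimage_comp, stoneCechExtend_extends hc]
  ext x
  simp [ULift.ext_iff, Set.boolIndicator]

/-- If `X` is a nonempty locally connected Tychonoff space all of whose connected components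
are non-compact, then there is a nonempty compact subset of `βX` disjoint from (the image of)
`X` which meets the closure of (the image of) every connected component of `X`. -/
theorem exists_compact_meeting_all_component_remainders
    {X : Type u} [TopologicalSpace X] [Nonempty X] [LocallyConnectedSpace X] [T35Space X]
    (hcomp : ∀ x : X, ¬ IsCompact (connectedComponent x)) :
    ∃ Z : Set (StoneCech X), Z.Nonempty ∧ IsCompact Z ∧
      Disjoint Z (Set.range (stoneCechUnit : X → StoneCech X)) ∧
      ∀ x : X,
        (Z ∩ closure ((stoneCechUnit : X → StoneCech X) '' connectedComponent x)).Nonempty := by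
  have hp (c : ConnectedComponents X) :
      ∃ p ∈ closure ((stoneCechUnit : X → StoneCech X) '' (ConnectedComponents.mk ⁻¹' {c})),
        p ∉ Set.range (stoneCechUnit : X → StoneCech X) := by
    obtain ⟨x, rfl⟩ := ConnectedComponents.surjective_coe c
    rw [connectedComponents_preimage_singleton]
    exact exists_mem_closure_image_stoneCechUnit_notMem_range isClosed_connectedComponent (hcomp x)
  choose p hpc hpr using hp
  have hpZ (c : ConnectedComponents X) : p c ∈ closure (Set.range p) :=
    subset_closure (Set.mem_range_self c)
  refine ⟨closure (Set.range p), ?_, isClosed_closure.isCompact, ?_, fun x => ?_⟩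
  · obtain ⟨x⟩ := ‹Nonempty X›
    exact ⟨_, hpZ (x : ConnectedComponents X)⟩
  · rw [Set.disjoint_right]
    rintro _ ⟨x, rfl⟩ hx
    obtain ⟨U, hU, hUx⟩ :=
      exists_isClopen_stoneCech_of_isClopen (isClopen_connectedComponent (x := x))
    have hxU : stoneCechUnit x ∈ U := by
      rw [← Set.mem_preimage, hUx]
      exact mem_connectedComponent
    have hxp : stoneCechUnit x ≠ p x := fun h => hpr x ⟨x, h⟩
    obtain ⟨_, ⟨hyU, hyp⟩, c, rfl⟩ :=
      mem_closure_iff.1 hx (U \ {p x}) (hU.2.sdiff isClosed_singleton) ⟨hxU, hxp⟩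
    obtain ⟨_, hzU, z, hz, rfl⟩ := mem_closure_iff.1 (hpc c) U hU.2 hyU
    rw [← Set.mem_preimage, hUx, ← connectedComponents_preimage_singleton] at hzU
    have hc : c = (x : ConnectedComponents X) := hz.symm.trans hzU
    exact hyp (congrArg p hc)
  · refine ⟨_, hpZ (x : ConnectedComponents X), ?_⟩
    rw [← connectedComponents_preimage_singleton]
    exact hpc _
end

section
/- Let X be a locally connected, locally compact Tychonoff (completely regular Hausdorff) space. If H is a nonempty subset of 𝒵(X) that has a lower bound in 𝒵(X) (i.e., some Z₀ ∈ 𝒵(X) is contained in every member of H), then the intersection ⋂ H belongs to 𝒵(X) and is the greatest lower bound of H in the partially ordered set (𝒵(X), ⊆). -/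
universe u

/-- `𝒵(X)`: the collection of all nonempty compact subsets of the Stone–Čech compactification
`βX` that are disjoint from (the image of) `X` and meet the closure of (the image of) every
connected component of `X`; it is partially ordered by inclusion. -/
def connectificationFamily (X : Type u) [TopologicalSpace X] : Set (Set (StoneCech X)) :=
  {Z | Z.Nonempty ∧ IsCompact Z ∧
    Disjoint Z (Set.range (stoneCechUnit : X → StoneCech X)) ∧
    ∀ x : X,
      (Z ∩ closure ((stoneCechUnit : X → StoneCech X) '' connectedComponent x)).Nonempty}

/-- In `𝒵(X)` (ordered by inclusion), for a locally connected locally compact Tychonoff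
space `X`, every nonempty subset `H` with a lower bound in `𝒵(X)` has `⋂₀ H` as its
greatest lower bound in `𝒵(X)`. -/
theorem connectificationFamily_sInter_isGLB
    {X : Type u} [TopologicalSpace X] [LocallyConnectedSpace X] [LocallyCompactSpace X]
    [T35Space X] (H : Set (Set (StoneCech X))) (hH : H ⊆ connectificationFamily X)
    (hne : H.Nonempty) (hlb : ∃ Z₀ ∈ connectificationFamily X, ∀ Z ∈ H, Z₀ ⊆ Z) :
    ⋂₀ H ∈ connectificationFamily X ∧ (∀ Z ∈ H, ⋂₀ H ⊆ Z) ∧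
      ∀ W ∈ connectificationFamily X, (∀ Z ∈ H, W ⊆ Z) → W ⊆ ⋂₀ H := by
  obtain ⟨Z₀, hZ₀, hle⟩ := hlb
  obtain ⟨Z, hZ⟩ := hne
  have hsub : Z₀ ⊆ ⋂₀ H := Set.subset_sInter hle
  refine ⟨⟨hZ₀.1.mono hsub, ?_, ?_, fun x => ?_⟩, fun Z hZ => Set.sInter_subset_of_mem hZ,
    fun W _ hW => Set.subset_sInter hW⟩
  · exact (isClosed_sInter fun Z hZ => (hH hZ).2.1.isClosed).isCompact
  · exact (hH hZ).2.2.1.mono_left (Set.sInter_subset_of_mem hZ)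
  · exact (hZ₀.2.2.2 x).mono (Set.inter_subset_inter_left _ hsub)
end

section
/- Let X be a locally connected, locally compact Tychonoff (completely regular Hausdorff) space. If H is a nonempty subset of 𝒵(X), then the closure in βX of the union ⋃ H belongs to 𝒵(X) and is the least upper bound of H in the partially ordered set (𝒵(X), ⊆). -/
universe u

/-- The range of a dense inducing map from a weakly locally compact space to a Hausdorff space
is open. -/
theorem IsDenseInducing.isOpen_range_of_weaklyLocallyCompact {X Y : Type*}
    [TopologicalSpace X] [TopologicalSpace Y] [WeaklyLocallyCompactSpace X] [T2Space Y]
    {i : X → Y} (hi : IsDenseInducing i) : IsOpen (Set.range i) := by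
  rw [isOpen_iff_mem_nhds]
  rintro _ ⟨x, rfl⟩
  obtain ⟨K, hK, hKx⟩ := exists_compact_mem_nhds x
  have hcl := hi.closure_image_mem_nhds hKx
  rw [(hK.image hi.continuous).isClosed.closure_eq] at hcl
  exact Filter.mem_of_superset hcl (Set.image_subset_range i K)

/-- In `𝒵(X)` (ordered by inclusion), for a locally connected locally compact Tychonoff
space `X`, every nonempty subset `H` has the closure in `βX` of `⋃₀ H` as its least upper
bound in `𝒵(X)`. -/
theorem connectificationFamily_closure_sUnion_isLUB
    {X : Type u} [TopologicalSpace X] [LocallyConnectedSpace X] [LocallyCompactSpace X]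
    [T35Space X] (H : Set (Set (StoneCech X))) (hH : H ⊆ connectificationFamily X)
    (hne : H.Nonempty) :
    closure (⋃₀ H) ∈ connectificationFamily X ∧ (∀ Z ∈ H, Z ⊆ closure (⋃₀ H)) ∧
      ∀ W ∈ connectificationFamily X, (∀ Z ∈ H, Z ⊆ W) → closure (⋃₀ H) ⊆ W := by
  have hopen : IsOpen (Set.range (stoneCechUnit : X → StoneCech X)) :=
    isDenseInducing_stoneCechUnit.isOpen_range_of_weaklyLocallyCompact
  have hsub : ∀ Z ∈ H, Z ⊆ closure (⋃₀ H) := fun Z hZ ↦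
    (Set.subset_sUnion_of_mem hZ).trans subset_closure
  obtain ⟨Z, hZ⟩ := hne
  refine ⟨⟨(hH hZ).1.mono (hsub Z hZ), isClosed_closure.isCompact, ?_, fun x ↦ ?_⟩, hsub, ?_⟩
  · exact Disjoint.closure_left (Set.disjoint_sUnion_left.2 fun Z hZ ↦ (hH hZ).2.2.1) hopen
  · exact ((hH hZ).2.2.2 x).mono (Set.inter_subset_inter_left _ (hsub Z hZ))
  · exact fun W hW hHW ↦ closure_minimal (Set.sUnion_subset hHW) hW.2.1.isClosed
end

section
/- Let X be a locally connected, locally compact Tychonoff (completely regular Hausdorff) space. If H is a nonempty subset of 𝒵(X) such that the intersection ⋂ H does not belong to 𝒵(X), then there exists a finite nonempty subset H' of H such that ⋂ H' does not belong to 𝒵(X). (Equivalently, the conditionally complete lattice 𝒵(X) is compact.) -/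
universe u

/-- In a compact space, a closed set that meets every finite nonempty subintersection of a family
of closed sets meets the whole intersection. -/
theorem sInter_inter_nonempty_of_finite {Y : Type*} [TopologicalSpace Y] [CompactSpace Y]
    {H : Set (Set Y)} {K : Set Y} (hne : H.Nonempty) (hcl : ∀ Z ∈ H, IsClosed Z)
    (hK : IsClosed K)
    (hfin : ∀ H' ⊆ H, H'.Finite → H'.Nonempty → (⋂₀ H' ∩ K).Nonempty) :
    (⋂₀ H ∩ K).Nonempty := by
  obtain ⟨Z₀, hZ₀⟩ := hne
  rw [Set.inter_comm, Set.sInter_eq_iInter]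
  refine hK.isCompact.inter_iInter_nonempty (fun Z : H => (Z : Set Y))
    (fun Z => hcl Z Z.2) fun u => ?_
  obtain ⟨y, hy, hyK⟩ := hfin (insert Z₀ (Subtype.val '' (u : Set H)))
    (by
      rintro _ (rfl | ⟨Z, -, rfl⟩)
      exacts [hZ₀, Z.2])
    ((u.finite_toSet.image _).insert _) (Set.insert_nonempty _ _)
  exact ⟨y, hyK, Set.mem_iInter₂.2 fun Z hZ =>
    hy _ (Set.mem_insert_of_mem _ (Set.mem_image_of_mem _ hZ))⟩

/-- Compactness of the lattice `𝒵(X)`: if `H` is a nonempty subset of `𝒵(X)` whose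
intersection is not in `𝒵(X)`, then already some finite nonempty subfamily of `H` has
intersection outside `𝒵(X)`. -/
theorem connectificationFamily_compact_lattice
    {X : Type u} [TopologicalSpace X] [LocallyConnectedSpace X] [LocallyCompactSpace X]
    [T35Space X] (H : Set (Set (StoneCech X))) (hH : H ⊆ connectificationFamily X)
    (hne : H.Nonempty) (hint : ⋂₀ H ∉ connectificationFamily X) :
    ∃ H' ⊆ H, H'.Finite ∧ H'.Nonempty ∧ ⋂₀ H' ∉ connectificationFamily X := by
  by_contra! hcon
  have hcl : ∀ Z ∈ H, IsClosed Z := fun Z hZ => (hH hZ).2.1.isClosed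
  refine hint ⟨?_, (isClosed_sInter hcl).isCompact, ?_, fun x => ?_⟩
  · have h := sInter_inter_nonempty_of_finite hne hcl isClosed_univ fun H' hs hf hn => by
      simpa only [Set.inter_univ] using (hcon H' hs hf hn).1
    simpa only [Set.inter_univ] using h
  · obtain ⟨Z₀, hZ₀⟩ := hne
    exact (hH hZ₀).2.2.1.mono_left (Set.sInter_subset_of_mem hZ₀)
  · exact sInter_inter_nonempty_of_finite hne hcl isClosed_closure fun H' hs hf hn =>
      (hcon H' hs hf hn).2.2.2 x
end

section
/- Let X be a locally connected, locally compact Tychonoff (completely regular Hausdorff) space with βX = StoneCech X and canonical embedding ι : X → βX. For M ∈ 𝒵(X), the following are equivalent: (1) M is a minimal element of (𝒵(X), ⊆), i.e., every Z ∈ 𝒵(X) with Z ⊆ M equals M; (2) there is a function m assigning to every connected component C of X a point m(C) ∈ closure(ι(C)) ∖ ι(X) such that M equals the closure in βX of the set {m(C) : C a connected component of X}. -/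
universe u

/-- In a closure of points chosen from the closures of the components of a locally connected space,
the only point in the closure of a given component is the one chosen there. -/
theorem eq_of_mem_closure_range_of_mem_closure_connectedComponent
    {X : Type u} [TopologicalSpace X] [LocallyConnectedSpace X]
    {m : ConnectedComponents X → StoneCech X}
    (hm : ∀ x : X, m (ConnectedComponents.mk x) ∈
      closure ((stoneCechUnit : X → StoneCech X) '' connectedComponent x))
    {x : X} {y : StoneCech X}
    (hyx : y ∈ closure ((stoneCechUnit : X → StoneCech X) '' connectedComponent x))
    (hym : y ∈ closure (Set.range m)) : y = m (ConnectedComponents.mk x) := by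
  have hclopen : IsClopen (connectedComponent x) :=
    ⟨isClosed_connectedComponent, isOpen_connectedComponent⟩
  have hg : Continuous (connectedComponent x).boolIndicator :=
    (continuous_boolIndicator_iff_isClopen _).2 hclopen
  have hext : ∀ (b : Bool) (s : Set X), (∀ z ∈ s, (connectedComponent x).boolIndicator z = b) →
      closure ((stoneCechUnit : X → StoneCech X) '' s) ⊆ stoneCechExtend hg ⁻¹' {b} := by
    intro b s hs
    refine closure_minimal ?_ ((isClosed_discrete {b}).preimage (continuous_stoneCechExtend hg))
    rintro _ ⟨z, hz, rfl⟩
    simpa [stoneCechExtend_stoneCechUnit] using hs z hz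
  have hopen : IsOpen (stoneCechExtend hg ⁻¹' {true}) :=
    (isOpen_discrete {true}).preimage (continuous_stoneCechExtend hg)
  have hy : y ∈ stoneCechExtend hg ⁻¹' {true} :=
    hext true _ (fun z hz => ((connectedComponent x).mem_iff_boolIndicator z).1 hz) hyx
  have hsub : stoneCechExtend hg ⁻¹' {true} ∩ Set.range m ⊆ {m (ConnectedComponents.mk x)} := by
    rintro _ ⟨hc, c, rfl⟩
    obtain ⟨x', rfl⟩ := ConnectedComponents.surjective_coe c
    by_contra hne
    have hdisj : Disjoint (connectedComponent x') (connectedComponent x) := by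
      refine connectedComponent_disjoint fun h => hne ?_
      rw [ConnectedComponents.coe_eq_coe.2 h]
      rfl
    have hfalse : m (ConnectedComponents.mk x') ∈ stoneCechExtend hg ⁻¹' {false} :=
      hext false _ (fun z hz => ((connectedComponent x).notMem_iff_boolIndicator z).1
        (Set.disjoint_left.1 hdisj hz)) (hm x')
    simp_all
  have := closure_mono hsub (hopen.inter_closure ⟨hy, hym⟩)
  simpa using this

/-- Characterization of the minimal elements of `𝒵(X)` for a locally connected, locally
compact Tychonoff space `X`: `M ∈ 𝒵(X)` is minimal iff `M` is the closure in `βX` of a set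
choosing exactly one point `m(C)` in `closure(ι(C)) \ ι(X)` for each connected
component `C` of `X`. -/
theorem connectificationFamily_minimal_iff
    {X : Type u} [TopologicalSpace X] [LocallyConnectedSpace X] [LocallyCompactSpace X]
    [T35Space X] (M : Set (StoneCech X)) (hM : M ∈ connectificationFamily X) :
    (∀ Z ∈ connectificationFamily X, Z ⊆ M → Z = M) ↔
      ∃ m : ConnectedComponents X → StoneCech X,
        (∀ x : X, m (ConnectedComponents.mk x) ∈
          closure ((stoneCechUnit : X → StoneCech X) '' connectedComponent x) \
            Set.range (stoneCechUnit : X → StoneCech X)) ∧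
        M = closure (Set.range m) := by
  obtain ⟨hne, hcomp, hdisj, hmeet⟩ := hM
  constructor
  · intro hmin
    have hchoice : ∀ c : ConnectedComponents X, ∃ y ∈ M, ∀ x, ConnectedComponents.mk x = c →
        y ∈ closure ((stoneCechUnit : X → StoneCech X) '' connectedComponent x) := by
      intro c
      obtain ⟨x, rfl⟩ := ConnectedComponents.surjective_coe c
      obtain ⟨y, hyM, hy⟩ := hmeet x
      refine ⟨y, hyM, fun x' hx' => ?_⟩
      rwa [ConnectedComponents.coe_eq_coe.1 hx']
    choose m hmM hm using hchoice
    have hsub : closure (Set.range m) ⊆ M :=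
      closure_minimal (Set.range_subset_iff.2 hmM) hcomp.isClosed
    have : Nonempty X := denseRange_stoneCechUnit.nonempty_iff.2 hne.nonempty
    refine ⟨m, fun x => ⟨hm _ x rfl, Set.disjoint_left.1 hdisj (hmM _)⟩,
      (hmin _ ⟨?_, isClosed_closure.isCompact, hdisj.mono_left hsub, fun x => ?_⟩ hsub).symm⟩
    · exact (Set.range_nonempty m).closure
    · exact ⟨m (ConnectedComponents.mk x), subset_closure (Set.mem_range_self _), hm _ x rfl⟩
  · rintro ⟨m, hm, rfl⟩ Z ⟨-, hZ, -, hZmeet⟩ hsub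
    refine hsub.antisymm (closure_minimal ?_ hZ.isClosed)
    rintro _ ⟨c, rfl⟩
    obtain ⟨x, rfl⟩ := ConnectedComponents.surjective_coe c
    obtain ⟨y, hyZ, hy⟩ := hZmeet x
    exact eq_of_mem_closure_range_of_mem_closure_connectedComponent (fun x => (hm x).1) hy
      (hsub hyZ) ▸ hyZ
end
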